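/- Part (a) of the equivalence theorem: if s* : Fin N → Bool is an RC-optimal solution, then its change-count tuple χ(s*) is RC_E-feasible and cost(s*) equals the RC_E-objective at χ(s*), i.e., cost(s*) = T_{G₀⁺}(a) + T_{G₁⁺}(b) + T_{G₀⁻}(c) + T_{G₁⁻}(d) where (a, b, c, d) = χ(s*). In particular, within each baseline group the examples changed by an RC-optimal solution achieve the minimum possible total confidence among subsets of that size. -/

import Mathlib

open Finset

def G0p {N : ℕ} (sh yh : Fin N → Bool) : Finset (Fin N) :=
  univ.filter (fun i => sh i = false ∧ yh i = true)
def G1p {N : ℕ} (sh yh : Fin N → Bool) : Finset (Fin N) :=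
  univ.filter (fun i => sh i = true ∧ yh i = true)
def G0m {N : ℕ} (sh yh : Fin N → Bool) : Finset (Fin N) :=
  univ.filter (fun i => sh i = false ∧ yh i = false)
def G1m {N : ℕ} (sh yh : Fin N → Bool) : Finset (Fin N) :=
  univ.filter (fun i => sh i = true ∧ yh i = false)

/-- a: changes 0→1 among positively-predicted examples -/
def chgA {N : ℕ} (sh yh s : Fin N → Bool) : ℕ :=
  ((G0p sh yh).filter (fun i => s i = true)).card
/-- b: changes 1→0 among positively-predicted examples -/
def chgB {N : ℕ} (sh yh s : Fin N → Bool) : ℕ :=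
  ((G1p sh yh).filter (fun i => s i = false)).card
/-- c: changes 0→1 among negatively-predicted examples -/
def chgC {N : ℕ} (sh yh s : Fin N → Bool) : ℕ :=
  ((G0m sh yh).filter (fun i => s i = true)).card
/-- d: changes 1→0 among negatively-predicted examples -/
def chgD {N : ℕ} (sh yh s : Fin N → Bool) : ℕ :=
  ((G1m sh yh).filter (fun i => s i = false)).card

/-- RC-feasibility: both protected groups nonempty, and the statistical parity
constraint with tolerance ε holds for each group of the reconstruction s. -/
def RCFeasible {N : ℕ} (yh : Fin N → Bool) (ε : ℝ) (s : Fin N → Bool) : Prop :=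
  (univ.filter (fun i => s i = true)).Nonempty ∧
  (univ.filter (fun i => s i = false)).Nonempty ∧
  ∀ g : Bool,
    |((univ.filter (fun i => yh i = true)).card : ℝ) / (N : ℝ) -
      ((univ.filter (fun i => s i = g ∧ yh i = true)).card : ℝ) /
        ((univ.filter (fun i => s i = g)).card : ℝ)| ≤ ε

/-- RC_E-feasibility of a change-count tuple (a,b,c,d). -/
def RCEFeasible (N k n0p n1p n0m n1m : ℕ) (ε : ℝ) (a b c d : ℕ) : Prop :=
  a ≤ n0p ∧ b ≤ n1p ∧ c ≤ n0m ∧ d ≤ n1m ∧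
  a + c < n0p + n0m + b + d ∧
  b + d < n1p + n1m + a + c ∧
  |(k : ℝ) / (N : ℝ) -
    ((n1p : ℝ) - (b : ℝ) + (a : ℝ)) /
      ((n1p : ℝ) + (n1m : ℝ) - (b : ℝ) - (d : ℝ) + (a : ℝ) + (c : ℝ))| ≤ ε ∧
  |(k : ℝ) / (N : ℝ) -
    ((n0p : ℝ) - (a : ℝ) + (b : ℝ)) /
      ((n0p : ℝ) + (n0m : ℝ) - (a : ℝ) - (c : ℝ) + (b : ℝ) + (d : ℝ))| ≤ ε

/-- Cost of a reconstruction: total confidence of changed positions. -/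
def cost {N : ℕ} (sh : Fin N → Bool) (p : Fin N → ℝ) (s : Fin N → Bool) : ℝ :=
  ∑ i ∈ univ.filter (fun i => s i ≠ sh i), p i

/-- T_G(j): the minimum total confidence of a size-j subset of G
(i.e., the sum of the j smallest confidence scores in G). -/
noncomputable def Tmin {N : ℕ} (G : Finset (Fin N)) (p : Fin N → ℝ) (j : ℕ) : ℝ :=
  sInf {x : ℝ | ∃ A : Finset (Fin N), A ⊆ G ∧ A.card = j ∧ x = ∑ i ∈ A, p i}

/-- The RC_E objective at a change-count tuple (a,b,c,d). -/
noncomputable def objE {N : ℕ} (sh yh : Fin N → Bool) (p : Fin N → ℝ)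
    (a b c d : ℕ) : ℝ :=
  Tmin (G0p sh yh) p a + Tmin (G1p sh yh) p b +
    Tmin (G0m sh yh) p c + Tmin (G1m sh yh) p d

section Tmin

variable {N : ℕ} (p : Fin N → ℝ)

theorem finite_setOf_sum_subset (G : Finset (Fin N)) (j : ℕ) :
    {x : ℝ | ∃ A : Finset (Fin N), A ⊆ G ∧ A.card = j ∧ x = ∑ i ∈ A, p i}.Finite :=
  (Set.finite_range fun A : Finset (Fin N) => ∑ i ∈ A, p i).subset <| by
    rintro x ⟨A, -, -, rfl⟩
    exact ⟨A, rfl⟩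

theorem Tmin_le_sum {A G : Finset (Fin N)} (hA : A ⊆ G) : Tmin G p A.card ≤ ∑ i ∈ A, p i :=
  csInf_le (finite_setOf_sum_subset p G A.card).bddBelow ⟨A, hA, rfl, rfl⟩

theorem exists_sum_eq_Tmin {G : Finset (Fin N)} {j : ℕ} (hj : j ≤ G.card) :
    ∃ A ⊆ G, A.card = j ∧ Tmin G p j = ∑ i ∈ A, p i := by
  obtain ⟨A, hA, hc⟩ := exists_subset_card_eq hj
  have hne : {x : ℝ | ∃ A : Finset (Fin N), A ⊆ G ∧ A.card = j ∧ x = ∑ i ∈ A, p i}.Nonempty :=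
    ⟨_, A, hA, hc, rfl⟩
  exact hne.csInf_mem (finite_setOf_sum_subset p G j)

end Tmin

section Counting

variable {N : ℕ} (sh yh s : Fin N → Bool)

theorem card_true_pos_add_chgB :
    (univ.filter fun i => s i = true ∧ yh i = true).card + chgB sh yh s =
      (G1p sh yh).card + chgA sh yh s := by
  simp only [chgA, chgB, G0p, G1p, filter_filter, card_filter, ← sum_add_distrib]
  refine sum_congr rfl fun i _ => ?_
  cases s i <;> cases sh i <;> cases yh i <;> rfl

theorem card_false_pos_add_chgA :
    (univ.filter fun i => s i = false ∧ yh i = true).card + chgA sh yh s =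
      (G0p sh yh).card + chgB sh yh s := by
  simp only [chgA, chgB, G0p, G1p, filter_filter, card_filter, ← sum_add_distrib]
  refine sum_congr rfl fun i _ => ?_
  cases s i <;> cases sh i <;> cases yh i <;> rfl

theorem card_true_add_chgB_add_chgD :
    (univ.filter fun i => s i = true).card + chgB sh yh s + chgD sh yh s =
      (G1p sh yh).card + (G1m sh yh).card + chgA sh yh s + chgC sh yh s := by
  simp only [chgA, chgB, chgC, chgD, G0p, G1p, G0m, G1m, filter_filter, card_filter,
    ← sum_add_distrib]
  refine sum_congr rfl fun i _ => ?_
  cases s i <;> cases sh i <;> cases yh i <;> rfl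

theorem card_false_add_chgA_add_chgC :
    (univ.filter fun i => s i = false).card + chgA sh yh s + chgC sh yh s =
      (G0p sh yh).card + (G0m sh yh).card + chgB sh yh s + chgD sh yh s := by
  simp only [chgA, chgB, chgC, chgD, G0p, G1p, G0m, G1m, filter_filter, card_filter,
    ← sum_add_distrib]
  refine sum_congr rfl fun i _ => ?_
  cases s i <;> cases sh i <;> cases yh i <;> rfl

theorem cost_eq_sum_changed (p : Fin N → ℝ) :
    cost sh p s =
      ∑ i ∈ (G0p sh yh).filter (fun i => s i = true), p i +
        ∑ i ∈ (G1p sh yh).filter (fun i => s i = false), p i +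
        ∑ i ∈ (G0m sh yh).filter (fun i => s i = true), p i +
        ∑ i ∈ (G1m sh yh).filter (fun i => s i = false), p i := by
  simp only [cost, G0p, G1p, G0m, G1m, filter_filter, sum_filter, ← sum_add_distrib]
  refine sum_congr rfl fun i _ => ?_
  cases s i <;> cases sh i <;> cases yh i <;> simp

/-- Feasibility of a reconstruction depends only on its change counts. -/
theorem rcFeasible_iff_rceFeasible (ε : ℝ) :
    RCFeasible yh ε s ↔
      RCEFeasible N (univ.filter (fun i => yh i = true)).card
        (G0p sh yh).card (G1p sh yh).card (G0m sh yh).card (G1m sh yh).card ε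
        (chgA sh yh s) (chgB sh yh s) (chgC sh yh s) (chgD sh yh s) := by
  have h1p := card_true_pos_add_chgB sh yh s
  have h0p := card_false_pos_add_chgA sh yh s
  have h1 := card_true_add_chgB_add_chgD sh yh s
  have h0 := card_false_add_chgA_add_chgC sh yh s
  have ha : chgA sh yh s ≤ (G0p sh yh).card := card_filter_le _ _
  have hb : chgB sh yh s ≤ (G1p sh yh).card := card_filter_le _ _
  have hc : chgC sh yh s ≤ (G0m sh yh).card := card_filter_le _ _
  have hd : chgD sh yh s ≤ (G1m sh yh).card := card_filter_le _ _
  have e1p := congrArg (Nat.cast (R := ℝ)) h1p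
  have e0p := congrArg (Nat.cast (R := ℝ)) h0p
  have e1 := congrArg (Nat.cast (R := ℝ)) h1
  have e0 := congrArg (Nat.cast (R := ℝ)) h0
  push_cast at e1p e0p e1 e0
  rw [RCFeasible, RCEFeasible, Bool.forall_bool, ← card_pos, ← card_pos,
    eq_sub_of_add_eq e1p, eq_sub_of_add_eq e0p, eq_sub_of_add_eq (eq_sub_of_add_eq e1),
    eq_sub_of_add_eq (eq_sub_of_add_eq e0)]
  rw [show ((G1p sh yh).card : ℝ) - chgB sh yh s + chgA sh yh s =
      (G1p sh yh).card + chgA sh yh s - chgB sh yh s by ring,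
    show ((G0p sh yh).card : ℝ) - chgA sh yh s + chgB sh yh s =
      (G0p sh yh).card + chgB sh yh s - chgA sh yh s by ring,
    show ((G1p sh yh).card : ℝ) + (G1m sh yh).card - chgB sh yh s - chgD sh yh s +
        chgA sh yh s + chgC sh yh s =
      (G1p sh yh).card + (G1m sh yh).card + chgA sh yh s + chgC sh yh s - chgD sh yh s -
        chgB sh yh s by ring,
    show ((G0p sh yh).card : ℝ) + (G0m sh yh).card - chgA sh yh s - chgC sh yh s +
        chgB sh yh s + chgD sh yh s =
      (G0p sh yh).card + (G0m sh yh).card + chgB sh yh s + chgD sh yh s - chgC sh yh s -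
        chgA sh yh s by ring]
  constructor
  · rintro ⟨hpos1, hpos0, hr0, hr1⟩
    exact ⟨ha, hb, hc, hd, by omega, by omega, hr1, hr0⟩
  · rintro ⟨-, -, -, -, hpos0, hpos1, hr1, hr0⟩
    exact ⟨by omega, by omega, hr0, hr1⟩

/-- Any choice of subsets of the baseline groups is the family of changed examples of some
reconstruction. -/
theorem exists_reconstruction_of_changed {A B C D : Finset (Fin N)} (hA : A ⊆ G0p sh yh)
    (hB : B ⊆ G1p sh yh) (hC : C ⊆ G0m sh yh) (hD : D ⊆ G1m sh yh) :
    ∃ t : Fin N → Bool,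
      (G0p sh yh).filter (fun i => t i = true) = A ∧
      (G1p sh yh).filter (fun i => t i = false) = B ∧
      (G0m sh yh).filter (fun i => t i = true) = C ∧
      (G1m sh yh).filter (fun i => t i = false) = D := by
  simp only [subset_iff, G0p, G1p, G0m, G1m, mem_filter, mem_univ, true_and] at hA hB hC hD
  refine ⟨fun i => if i ∈ A ∨ i ∈ B ∨ i ∈ C ∨ i ∈ D then !sh i else sh i, ?_, ?_, ?_, ?_⟩ <;>
  · ext i
    have hAi := @hA i
    have hBi := @hB i
    have hCi := @hC i
    have hDi := @hD i
    simp only [G0p, G1p, G0m, G1m, mem_filter, mem_univ, true_and]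
    grind

end Counting

theorem rc_optimal_implies_rce_feasible_and_cost_eq_objE (N : ℕ) (hN : 1 ≤ N)
    (sh yh : Fin N → Bool) (p : Fin N → ℝ) (hp : ∀ i, 0 ≤ p i)
    (ε : ℝ) (hε : 0 ≤ ε) (s : Fin N → Bool)
    (hfeas : RCFeasible yh ε s)
    (hopt : ∀ s' : Fin N → Bool, RCFeasible yh ε s' → cost sh p s ≤ cost sh p s') :
    RCEFeasible N (univ.filter (fun i => yh i = true)).card
      (G0p sh yh).card (G1p sh yh).card (G0m sh yh).card (G1m sh yh).card ε
      (chgA sh yh s) (chgB sh yh s) (chgC sh yh s) (chgD sh yh s) ∧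
    cost sh p s =
      objE sh yh p (chgA sh yh s) (chgB sh yh s) (chgC sh yh s) (chgD sh yh s) := by
  refine ⟨(rcFeasible_iff_rceFeasible sh yh s ε).1 hfeas, le_antisymm ?_ ?_⟩
  · obtain ⟨A, hA, hAc, hAT⟩ := exists_sum_eq_Tmin p
      (card_filter_le (G0p sh yh) fun i => s i = true)
    obtain ⟨B, hB, hBc, hBT⟩ := exists_sum_eq_Tmin p
      (card_filter_le (G1p sh yh) fun i => s i = false)
    obtain ⟨C, hC, hCc, hCT⟩ := exists_sum_eq_Tmin p
      (card_filter_le (G0m sh yh) fun i => s i = true)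
    obtain ⟨D, hD, hDc, hDT⟩ := exists_sum_eq_Tmin p
      (card_filter_le (G1m sh yh) fun i => s i = false)
    obtain ⟨t, htA, htB, htC, htD⟩ := exists_reconstruction_of_changed sh yh hA hB hC hD
    have hle := hopt t <| by
      rw [rcFeasible_iff_rceFeasible sh] at hfeas ⊢
      rwa [chgA, chgB, chgC, chgD, htA, htB, htC, htD, hAc, hBc, hCc, hDc]
    rw [cost_eq_sum_changed sh yh t, htA, htB, htC, htD] at hle
    rwa [objE, chgA, chgB, chgC, chgD, hAT, hBT, hCT, hDT]
  · rw [cost_eq_sum_changed sh yh s]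
    exact add_le_add (add_le_add (add_le_add (Tmin_le_sum p (filter_subset _ _))
      (Tmin_le_sum p (filter_subset _ _))) (Tmin_le_sum p (filter_subset _ _)))
      (Tmin_le_sum p (filter_subset _ _))
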